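/- Let $(f_i : F_i \twoheadrightarrow M_i)_{i\in I}$ be a family of surjective $R$-module homomorphisms in which every $M_i$ is separated and every $F_i$ is flat, and assume that for each $n \ge 1$ the induced maps $\overline{f_i} : F_i/\mathfrak m^n F_i \to M_i/\mathfrak m^n M_i$ are isomorphisms for all but finitely many $i \in I$. Then the canonical map $\widehat{\bigoplus_{i\in I} M_i} \to \widehat{\prod_{i\in I} M_i}$ of $\mathfrak m$-adic completions is a split monomorphism. -/

import Mathlib

/- Throughout, `(R, 𝔪)` is a commutative noetherian local ring and all modules are `R`-modules.
`AdicCompletion (maximalIdeal R) M` is the `𝔪`-adic completion `lim M/𝔪^n M` and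
`IsHausdorff (maximalIdeal R) M` says that `M` is (`𝔪`-adically) separated. -/

open TensorProduct IsLocalRing

universe u

section Definitions

variable (R : Type u) [CommRing R]

/-- A linear map is a *pure monomorphism* if it is injective and remains injective after
tensoring with an arbitrary module. -/
def IsPureMono {M N : Type u} [AddCommGroup M] [Module R M] [AddCommGroup N] [Module R N]
    (f : M →ₗ[R] N) : Prop :=
  Function.Injective f ∧
    ∀ (X : Type u) [AddCommGroup X] [Module R X], Function.Injective (LinearMap.lTensor X f)

/-- A module `N` is *pure-injective* if every pure monomorphism out of `N` splits. -/
def IsPureInjective (N : Type u) [AddCommGroup N] [Module R N] : Prop :=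
  ∀ (Y : Type u) [AddCommGroup Y] [Module R Y] (f : N →ₗ[R] Y),
    IsPureMono R f → ∃ g : Y →ₗ[R] N, g ∘ₗ f = LinearMap.id

/-- A submodule `A ⊆ B` is *pure* if its inclusion is a pure monomorphism. -/
def IsPureSubmodule {B : Type u} [AddCommGroup B] [Module R B] (A : Submodule R B) : Prop :=
  IsPureMono R A.subtype

/-- An extension `A ⊆ B` is *pure-essential* if `A` is pure in `B` and for every submodule
`X ⊆ B` with `X ⊓ A = 0` such that `(X ⊕ A)/X` is pure in `B/X`, one has `X = 0`. -/
def IsPureEssential {B : Type u} [AddCommGroup B] [Module R B] (A : Submodule R B) : Prop :=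
  IsPureSubmodule R A ∧
    ∀ X : Submodule R B, X ⊓ A = ⊥ → IsPureMono R (X.mkQ ∘ₗ A.subtype) → X = ⊥

/-- An extension `A ⊆ B` is *strictly pure-essential* if it is pure-essential and for every
extension `B ⊆ Y` in which `A` is pure in `Y`, also `B` is pure in `Y`. -/
def IsStrictlyPureEssential {B : Type u} [AddCommGroup B] [Module R B] (A : Submodule R B) :
    Prop :=
  IsPureEssential R A ∧
    ∀ (Y : Type u) [AddCommGroup Y] [Module R Y] (g : B →ₗ[R] Y),
      Function.Injective g → IsPureMono R (g ∘ₗ A.subtype) → IsPureMono R g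

/-- A module `M` over a local ring is *totally separated* if `X ⊗[R] M` is `𝔪`-adically
separated for every finitely generated `R`-module `X`. -/
def IsTotallySeparatedModule [IsLocalRing R] (M : Type u) [AddCommGroup M] [Module R M] :
    Prop :=
  ∀ (X : Type u) [AddCommGroup X] [Module R X] [Module.Finite R X],
    IsHausdorff (maximalIdeal R) (X ⊗[R] M)

end Definitions

/-- Nakayama's lemma for a nilpotent ideal, without finiteness assumptions. -/
theorem Submodule.eq_top_of_sup_smul_top_eq_top {R P : Type*} [CommRing R] [AddCommGroup P]
    [Module R P] {I : Ideal R} (hI : IsNilpotent I) {N : Submodule R P}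
    (hN : N ⊔ I • ⊤ = ⊤) : N = ⊤ := by
  obtain ⟨n, hn⟩ := hI
  have key : ∀ k : ℕ, N ⊔ I ^ k • ⊤ = ⊤ := by
    intro k
    induction k with
    | zero => simp
    | succ k ih =>
      refine eq_top_iff.2 (ih.ge.trans (sup_le le_sup_left ?_))
      calc I ^ k • (⊤ : Submodule R P) = I ^ k • N ⊔ I ^ k • I • ⊤ := by
            rw [← Submodule.smul_sup, hN]
        _ ≤ N ⊔ I ^ (k + 1) • ⊤ :=
            sup_le_sup Submodule.smul_le_right (by rw [pow_succ, Submodule.mul_smul])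
  simpa [hn] using key n

/-- A flat module over a local ring with nilpotent maximal ideal is free. -/
theorem IsLocalRing.free_of_flat_of_isNilpotent {S P : Type u} [CommRing S] [IsLocalRing S]
    (hS : IsNilpotent (maximalIdeal S)) [AddCommGroup P] [Module S P] [Module.Flat S P] :
    Module.Free S P := by
  let k := ResidueField S
  let w := Module.Basis.ofVectorSpace k (k ⊗[S] P)
  have hsurj := TensorProduct.mk_surjective S P k Ideal.Quotient.mk_surjective
  obtain ⟨v, hv⟩ : ∃ v, TensorProduct.mk S k P 1 ∘ v = w := hsurj.comp_left w
  refine .of_basis <| .mk (Module.IsLocalRing.linearIndependent_of_flat v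
    (hv.symm ▸ w.linearIndependent)) ?_
  refine (Submodule.eq_top_of_sup_smul_top_eq_top hS ?_).ge
  have hker : LinearMap.ker (TensorProduct.mk S k P 1) = maximalIdeal S • ⊤ :=
    LinearMap.ker_tensorProductMk ..
  have hmap : (Submodule.span S (Set.range v)).map (TensorProduct.mk S k P 1) = ⊤ := by
    rw [Submodule.map_span, ← Set.range_comp]
    have h := Submodule.restrictScalars_span S k Ideal.Quotient.mk_surjective (Set.range w)
    rw [w.span_eq, Submodule.restrictScalars_top] at h
    exact (congrArg (fun t ↦ Submodule.span S (Set.range t)) hv).trans h.symm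
  rw [← hker, ← Submodule.comap_map_eq, hmap, Submodule.comap_top]

theorem Submodule.smul_top_le_ker_of_le {R A B : Type*} [CommRing R] [AddCommGroup A] [Module R A]
    [AddCommGroup B] [Module R B] {I J : Ideal R} (h : J ≤ I)
    (φ : B →ₗ[R] A ⧸ (I • ⊤ : Submodule R A)) : (J • ⊤ : Submodule R B) ≤ LinearMap.ker φ := by
  refine Submodule.smul_le.2 fun r hr b _ ↦ ?_
  obtain ⟨a, ha⟩ := Submodule.mkQ_surjective _ (φ b)
  rw [LinearMap.mem_ker, map_smul, ← ha, ← map_smul]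
  exact (Submodule.Quotient.mk_eq_zero _).2 (Submodule.smul_mem_smul (h hr) trivial)

/-- If `R ⧸ I` is local with nilpotent maximal ideal, maps from a flat module that factor through
`B ⧸ I • ⊤` lift along surjections from `A ⧸ I • ⊤`. -/
theorem exists_linearMap_comp_eq_of_flat_of_isNilpotent {R A B Y : Type u} [CommRing R]
    [AddCommGroup A] [Module R A] [AddCommGroup B] [Module R B] [AddCommGroup Y] [Module R Y]
    [Module.Flat R B] (I : Ideal R) [IsLocalRing (R ⧸ I)]
    (hI : IsNilpotent (maximalIdeal (R ⧸ I)))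
    (g : (A ⧸ (I • ⊤ : Submodule R A)) →ₗ[R] Y) (hg : Function.Surjective g) (φ : B →ₗ[R] Y)
    (hφ : (I • ⊤ : Submodule R B) ≤ LinearMap.ker φ) :
    ∃ ψ : B →ₗ[R] A ⧸ (I • ⊤ : Submodule R A), g ∘ₗ ψ = φ := by
  have := free_of_flat_of_isNilpotent hI (P := (R ⧸ I) ⊗[R] B)
  let b := Module.Free.chooseBasis (R ⧸ I) ((R ⧸ I) ⊗[R] B)
  let L : (R ⧸ I) ⊗[R] B →ₗ[R] Y :=
    (I • ⊤ : Submodule R B).liftQ φ hφ ∘ₗ (quotTensorEquivQuotSMul B I).toLinearMap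
  choose x hx using fun j ↦ hg (L (b j))
  let ψ := (b.constr ℕ x).restrictScalars R
  have hψ : g ∘ₗ ψ = L := by
    have hb : Submodule.span R (Set.range b) = ⊤ := by
      have h := Submodule.restrictScalars_span R (R ⧸ I) Ideal.Quotient.mk_surjective (Set.range b)
      rw [b.span_eq, Submodule.restrictScalars_top] at h
      exact h.symm
    refine LinearMap.ext_on_range hb fun j ↦ ?_
    simp [ψ, hx]
  refine ⟨ψ ∘ₗ TensorProduct.mk R (R ⧸ I) B 1, ?_⟩
  rw [← LinearMap.comp_assoc, hψ]
  ext y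
  simp [L]

theorem IsLocalRing.exists_lift_factorPowSucc {R A B : Type u} [CommRing R] [IsLocalRing R]
    [AddCommGroup A] [Module R A] [AddCommGroup B] [Module R B] [Module.Flat R B] (n : ℕ)
    (φ : B →ₗ[R] A ⧸ (maximalIdeal R ^ n • ⊤ : Submodule R A)) :
    ∃ ψ : B →ₗ[R] A ⧸ (maximalIdeal R ^ (n + 1) • ⊤ : Submodule R A),
      Submodule.factorPowSucc (maximalIdeal R) A n ∘ₗ ψ = φ := by
  let m := maximalIdeal R
  have hle : m ^ (n + 1) ≤ m := Ideal.pow_le_self n.succ_ne_zero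
  have : Nontrivial (R ⧸ m ^ (n + 1)) :=
    Ideal.Quotient.nontrivial_iff.2 fun h ↦ Ideal.IsPrime.ne_top' (top_le_iff.1 (h ▸ hle))
  have : IsLocalRing (R ⧸ m ^ (n + 1)) :=
    .of_surjective' (Ideal.Quotient.mk (m ^ (n + 1))) Ideal.Quotient.mk_surjective
  refine exists_linearMap_comp_eq_of_flat_of_isNilpotent (m ^ (n + 1)) ⟨n + 1, ?_⟩
    (Submodule.factorPowSucc m A n) (Submodule.factor_surjective _) φ
    (Submodule.smul_top_le_ker_of_le (Ideal.pow_le_pow_right n.le_succ) φ)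
  have : maximalIdeal (R ⧸ m ^ (n + 1)) = m.map (Ideal.Quotient.mk _) :=
    (IsLocalRing.map_maximalIdeal_of_surjective _ Ideal.Quotient.mk_surjective).symm
  rw [this, ← Ideal.map_pow, Ideal.map_quotient_self]
  rfl

/-- If `j` is injective modulo the maximal ideal, a map killing `𝔪 • ⊤` extends along `j`, without
enlarging its range. -/
theorem IsLocalRing.exists_extension_of_smul_top_le_ker {R A B W : Type*} [CommRing R]
    [IsLocalRing R] [AddCommGroup A] [Module R A] [AddCommGroup B] [Module R B]
    [AddCommGroup W] [Module R W] (j : A →ₗ[R] B)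
    (hj : (maximalIdeal R • ⊤ : Submodule R B).comap j ≤ maximalIdeal R • ⊤)
    (D : A →ₗ[R] W) (hD : (maximalIdeal R • ⊤ : Submodule R A) ≤ LinearMap.ker D) :
    ∃ E : B →ₗ[R] W, E ∘ₗ j = D ∧ LinearMap.range E ≤ LinearMap.range D := by
  let _ := Ideal.Quotient.field (maximalIdeal R)
  obtain ⟨h, hh⟩ := (j.reduceModIdeal (maximalIdeal R)).exists_leftInverse_of_injective <| by
    refine LinearMap.ker_eq_bot'.2 fun x hx ↦ ?_
    obtain ⟨a, rfl⟩ := Submodule.mkQ_surjective _ x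
    rw [Submodule.mkQ_apply, LinearMap.reduceModIdeal_apply, Submodule.Quotient.mk_eq_zero] at hx
    exact (Submodule.Quotient.mk_eq_zero _).2 (hj hx)
  refine ⟨Submodule.liftQ _ D hD ∘ₗ h.restrictScalars R ∘ₗ Submodule.mkQ _, ?_, ?_⟩
  · ext a
    have := LinearMap.congr_fun hh (Submodule.Quotient.mk a)
    simp only [LinearMap.comp_apply, LinearMap.reduceModIdeal_apply, LinearMap.id_apply] at this
    simp [this]
  · exact (LinearMap.range_comp_le_range _ _).trans (Submodule.range_liftQ _ _ _).le

/-- If `j : A → B` is injective modulo the maximal ideal and `B` is flat, the canonical map from `A`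
to its completion extends along `j`. -/
theorem AdicCompletion.exists_comp_eq_of_of_flat {R A B : Type u} [CommRing R] [IsLocalRing R]
    [AddCommGroup A] [Module R A] [AddCommGroup B] [Module R B] [Module.Flat R B]
    (j : A →ₗ[R] B)
    (hj : (maximalIdeal R • ⊤ : Submodule R B).comap j ≤ maximalIdeal R • ⊤) :
    ∃ r : B →ₗ[R] AdicCompletion (maximalIdeal R) A, r ∘ₗ j = AdicCompletion.of _ A := by
  let m := maximalIdeal R
  have step (n : ℕ) (φ : {φ : B →ₗ[R] A ⧸ (m ^ n • ⊤ : Submodule R A) //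
      φ ∘ₗ j = Submodule.mkQ _}) :
      ∃ ψ : {ψ : B →ₗ[R] A ⧸ (m ^ (n + 1) • ⊤ : Submodule R A) // ψ ∘ₗ j = Submodule.mkQ _},
        Submodule.factorPowSucc m A n ∘ₗ ψ.1 = φ.1 := by
    obtain ⟨φ, hφ⟩ := φ
    obtain ⟨ψ, hψ⟩ : ∃ ψ : B →ₗ[R] A ⧸ (m ^ (n + 1) • ⊤ : Submodule R A),
      Submodule.factorPowSucc m A n ∘ₗ ψ = φ := exists_lift_factorPowSucc n φ
    let D := Submodule.mkQ _ - ψ ∘ₗ j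
    have hD (a : A) : Submodule.factorPowSucc m A n (D a) = 0 := by
      have h1 := LinearMap.congr_fun hψ (j a)
      have h2 := LinearMap.congr_fun hφ a
      simp only [LinearMap.comp_apply] at h1 h2
      simp [D, h1, h2]
    obtain ⟨E, hE, hED⟩ := exists_extension_of_smul_top_le_ker j hj D <| by
      refine Submodule.smul_le.2 fun r hr a _ ↦ ?_
      obtain ⟨c, hc⟩ := Submodule.mkQ_surjective _ (D a)
      have hcm : c ∈ (m ^ n • ⊤ : Submodule R A) := by
        rw [← Submodule.Quotient.mk_eq_zero, ← hD a, ← hc]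
        rfl
      rw [LinearMap.mem_ker, map_smul, ← hc, ← map_smul]
      refine (Submodule.Quotient.mk_eq_zero _).2 ?_
      rw [pow_succ', Submodule.mul_smul]
      exact Submodule.smul_mem_smul hr hcm
    refine ⟨⟨ψ + E, ?_⟩, ?_⟩
    · rw [LinearMap.add_comp, hE, add_sub_cancel]
    · ext b
      obtain ⟨a, ha⟩ := hED ⟨b, rfl⟩
      have := hD a
      rw [ha] at this
      simp [← hψ, this]
  choose next hnext using step
  have : Subsingleton (A ⧸ (m ^ 0 • ⊤ : Submodule R A)) := by
    simp
  let s : ∀ n, {φ : B →ₗ[R] A ⧸ (m ^ n • ⊤ : Submodule R A) // φ ∘ₗ j = Submodule.mkQ _} :=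
    fun n ↦ Nat.rec ⟨0, LinearMap.ext fun _ ↦ Subsingleton.elim _ _⟩ next n
  have hs {k n : ℕ} (hkn : k ≤ n) : transitionMap m A hkn ∘ₗ (s n).1 = (s k).1 := by
    induction n, hkn using Nat.le_induction with
    | base =>
      exact (congrArg (· ∘ₗ (s k).1) (Submodule.mapQ_id (m ^ k • ⊤ : Submodule R A) le_rfl)).trans
        (LinearMap.id_comp _)
    | succ n hkn ih =>
      rw [← ih, ← hnext n (s n), ← LinearMap.comp_assoc]
      congr 1
      ext
      rfl
  refine ⟨AdicCompletion.lift m (fun n ↦ (s n).1) hs, ?_⟩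
  ext a n
  exact LinearMap.congr_fun (s n).2 a

/-- An extension of the canonical map `A → Â` along `j` yields a left inverse of the completion
of `j`. -/
theorem AdicCompletion.exists_leftInverse_map {R A B : Type*} [CommRing R] (I : Ideal R)
    [AddCommGroup A] [Module R A] [AddCommGroup B] [Module R B] (j : A →ₗ[R] B)
    (s : B →ₗ[R] AdicCompletion I A) (hs : s ∘ₗ j = AdicCompletion.of I A) :
    ∃ g : AdicCompletion I B →ₗ[R] AdicCompletion I A,
      g ∘ₗ (AdicCompletion.map I j).restrictScalars R = LinearMap.id := by
  refine ⟨AdicCompletion.lift I (fun n ↦ Submodule.liftQ _ (AdicCompletion.eval I A n ∘ₗ s)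
    (Submodule.smul_top_le_ker_of_le le_rfl _) ∘ₗ AdicCompletion.eval I B n) ?_, ?_⟩
  · intro k n hkn
    refine LinearMap.ext fun x ↦ ?_
    obtain ⟨b, hb⟩ := Submodule.mkQ_surjective (I ^ n • ⊤ : Submodule R B) (x.val n)
    have hb' : x.val k = Submodule.mkQ _ b := by
      rw [← x.property hkn, ← hb]
      rfl
    simp [hb', ← hb]
  · refine LinearMap.ext fun x ↦ AdicCompletion.ext fun n ↦ ?_
    obtain ⟨a, ha⟩ := Submodule.mkQ_surjective (I ^ n • ⊤ : Submodule R A) (x.val n)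
    have := congrArg (fun y ↦ y.val n) (LinearMap.congr_fun hs a)
    simpa [← ha] using this

/-- For a finitely generated ideal `I`, membership in `I • ⊤` of a product is componentwise. -/
theorem Submodule.mem_smul_top_pi {R ι : Type*} [CommRing R] {F : ι → Type*}
    [∀ i, AddCommGroup (F i)] [∀ i, Module R (F i)] {I : Ideal R} (hI : I.FG)
    (x : ∀ i, F i) (hx : ∀ i, x i ∈ (I • ⊤ : Submodule R (F i))) :
    x ∈ (I • ⊤ : Submodule R (∀ i, F i)) := by
  induction I, hI using Submodule.fg_induction generalizing x with
  | singleton r =>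
    have hr (i : ι) : ∃ z, r • z = x i := by
      have := hx i
      rw [Ideal.submodule_span_eq, Submodule.ideal_span_singleton_smul,
        Submodule.mem_smul_pointwise_iff_exists] at this
      simpa using this
    choose z hz using hr
    rw [← show r • z = x from funext hz]
    exact Submodule.smul_mem_smul (Submodule.mem_span_singleton_self r) trivial
  | sup I J _ _ hI hJ =>
    simp only [Submodule.sup_smul, Submodule.mem_sup] at hx ⊢
    choose y hy z hz h using hx
    exact ⟨y, hI y hy, z, hJ z hz, funext h⟩

/-- Arbitrary products of flat modules over a noetherian ring are flat. -/
theorem Module.Flat.pi_of_isNoetherianRing {R : Type*} {ι : Type*} [CommRing R] [IsNoetherianRing R]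
    {F : ι → Type*} [∀ i, AddCommGroup (F i)] [∀ i, Module R (F i)] [∀ i, Module.Flat R (F i)] :
    Module.Flat R (∀ i, F i) := by
  refine .of_forall_isTrivialRelation fun {l f x} h ↦ ?_
  let φ : (Fin l → R) →ₗ[R] R := Fintype.linearCombination R f
  obtain ⟨q, c, hc⟩ := Submodule.fg_iff_exists_fin_generating_family.1
    (IsNoetherian.noetherian (LinearMap.ker φ))
  have key (i : ι) : ∃ z : Fin q → F i, ∀ j, x j i = ∑ t, c t j • z t := by
    have hi : ∑ j, f j • x j i = 0 := by simpa using congrFun h i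
    obtain ⟨k, a, y, hy, ha⟩ := Module.Flat.isTrivialRelation_of_sum_smul_eq_zero hi
    have hmem (p : Fin k) : (fun j ↦ a j p) ∈ Submodule.span R (Set.range c) := by
      rw [hc, LinearMap.mem_ker, Fintype.linearCombination_apply]
      simpa [mul_comm] using ha p
    simp only [Submodule.mem_span_range_iff_exists_fun] at hmem
    choose d hd using hmem
    refine ⟨fun t ↦ ∑ p, d p t • y p, fun j ↦ ?_⟩
    have hd' (p : Fin k) : a j p = ∑ t, d p t * c t j := by
      simpa using (congrFun (hd p) j).symm
    simp_rw [hy j, hd', Finset.sum_smul, Finset.smul_sum, smul_smul]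
    rw [Finset.sum_comm]
    simp_rw [mul_comm]
  choose z hz using key
  refine ⟨q, fun j t ↦ c t j, fun t i ↦ z i t, fun j ↦ ?_, fun t ↦ ?_⟩
  · ext i
    simp [hz]
  · have : c t ∈ LinearMap.ker φ := hc ▸ Submodule.subset_span ⟨t, rfl⟩
    simpa [φ, Fintype.linearCombination_apply, mul_comm] using this

theorem DFinsupp.comap_smul_top_pi_le {R ι : Type*} [CommRing R] (I : Ideal R) {F : ι → Type*}
    [∀ i, AddCommGroup (F i)] [∀ i, Module R (F i)] :
    (I • ⊤ : Submodule R (∀ i, F i)).comap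
      (LinearMap.pi (fun i ↦ DFinsupp.lapply i) : (Π₀ i, F i) →ₗ[R] (i : ι) → F i) ≤ I • ⊤ := by
  classical
  intro a ha
  rw [← DFinsupp.sum_single (f := a)]
  refine Submodule.sum_mem _ fun i _ ↦ ?_
  have hai : a i ∈ (I • ⊤ : Submodule R (F i)) :=
    Submodule.smul_top_le_comap_smul_top I (LinearMap.proj i) ha
  exact Submodule.smul_top_le_comap_smul_top I (DFinsupp.lsingle i) hai

/-- Let `f i : F i → M i` be surjective with every `M i` separated and every
`F i` flat, and assume for each `n ≥ 1` the induced maps `F i/𝔪^n F i → M i/𝔪^n M i` are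
bijective for all but finitely many `i`. Then `(⊕ M i)^ → (∏ M i)^` splits. -/
theorem completion_sum_prod_split (R : Type u) [CommRing R] [IsNoetherianRing R]
    [IsLocalRing R] {ι : Type u} (F M : ι → Type u)
    [∀ i, AddCommGroup (F i)] [∀ i, Module R (F i)]
    [∀ i, AddCommGroup (M i)] [∀ i, Module R (M i)]
    (f : ∀ i, F i →ₗ[R] M i) (hsurj : ∀ i, Function.Surjective (f i))
    (hsep : ∀ i, IsHausdorff (maximalIdeal R) (M i)) (hflat : ∀ i, Module.Flat R (F i))
    (hiso : ∀ n : ℕ, 1 ≤ n →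
      {i : ι | ¬ Function.Bijective
        (Submodule.mapQ (maximalIdeal R ^ n • ⊤ : Submodule R (F i))
          (maximalIdeal R ^ n • ⊤ : Submodule R (M i)) (f i)
          (by
            rw [← Submodule.map_le_iff_le_comap, Submodule.map_smul'']
            exact Submodule.smul_mono le_rfl le_top))}.Finite) :
    ∃ g : AdicCompletion (maximalIdeal R) ((i : ι) → M i) →ₗ[R]
        AdicCompletion (maximalIdeal R) (Π₀ i, M i),
      g ∘ₗ ((AdicCompletion.map (maximalIdeal R)
          (LinearMap.pi (fun i => DFinsupp.lapply i) :
            (Π₀ i, M i) →ₗ[R] (i : ι) → M i)).restrictScalars R) = LinearMap.id := by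
  let m := maximalIdeal R
  let jF : (Π₀ i, F i) →ₗ[R] (i : ι) → F i := LinearMap.pi (fun i => DFinsupp.lapply i)
  let jM : (Π₀ i, M i) →ₗ[R] (i : ι) → M i := LinearMap.pi (fun i => DFinsupp.lapply i)
  let fs : (Π₀ i, F i) →ₗ[R] Π₀ i, M i := DFinsupp.mapRange.linearMap f
  let fp : ((i : ι) → F i) →ₗ[R] (i : ι) → M i := LinearMap.piMap f
  have hfs : Function.Surjective fs :=
    (DFinsupp.mapRange_surjective _ fun i ↦ map_zero (f i)).2 hsurj
  have hfp : Function.Surjective fp := Function.Surjective.piMap hsurj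
  have := Module.Flat.pi_of_isNoetherianRing (R := R) (F := F)
  obtain ⟨r, hr⟩ := AdicCompletion.exists_comp_eq_of_of_flat jF (DFinsupp.comap_smul_top_pi_le m)
  let s₀ := (AdicCompletion.map m fs).restrictScalars R ∘ₗ r
  have hs₀ (a : Π₀ i, F i) : s₀ (jF a) = AdicCompletion.of m _ (fs a) := by
    have := LinearMap.congr_fun hr a
    rw [LinearMap.comp_apply] at this
    simp only [s₀, LinearMap.comp_apply, this]
    rfl
  have hker : LinearMap.ker fp ≤ LinearMap.ker s₀ := by
    classical
    intro k hk
    have hk (i : ι) : f i (k i) = 0 := congrFun hk i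
    refine AdicCompletion.ext fun n ↦ ?_
    obtain ⟨T, hT⟩ : ∃ T : Finset ι, ∀ i ∉ T, k i ∈ (m ^ n • ⊤ : Submodule R (F i)) := by
      obtain rfl | hn := n.eq_zero_or_pos
      · exact ⟨∅, by simp⟩
      refine ⟨(hiso n hn).toFinset, fun i hi ↦ ?_⟩
      rw [Set.Finite.mem_toFinset, Set.mem_ofPred_eq, not_not] at hi
      rw [← Submodule.Quotient.mk_eq_zero]
      refine hi.1 ?_
      rw [map_zero, Submodule.mapQ_apply, hk, Submodule.Quotient.mk_zero]
    let a : Π₀ i, F i := DFinsupp.mk T fun i ↦ k i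
    have ha : fs a = 0 := by
      ext i
      by_cases hi : i ∈ T <;> simp [fs, a, hi, hk]
    have hka : k - jF a ∈ (m ^ n • ⊤ : Submodule R ((i : ι) → F i)) := by
      refine Submodule.mem_smul_top_pi (IsNoetherian.noetherian _) _ fun i ↦ ?_
      by_cases hi : i ∈ T
      · simp [jF, a, hi]
      · simpa [jF, a, hi] using hT i hi
    have h := Submodule.smul_top_le_ker_of_le le_rfl (AdicCompletion.eval m _ n ∘ₗ s₀) hka
    rw [LinearMap.mem_ker, LinearMap.comp_apply, map_sub, hs₀, ha, map_zero, sub_zero] at h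
    exact h
  obtain ⟨s, hs⟩ : ∃ s : ((i : ι) → M i) →ₗ[R] AdicCompletion m (Π₀ i, M i), s ∘ₗ fp = s₀ :=
    ⟨(LinearMap.ker fp).liftQ s₀ hker ∘ₗ (fp.quotKerEquivOfSurjective hfp).symm, by
      ext1 x
      have : (fp.quotKerEquivOfSurjective hfp).symm (fp x) = Submodule.Quotient.mk x := by
        rw [LinearEquiv.symm_apply_eq]
        rfl
      simp [this]⟩
  refine AdicCompletion.exists_leftInverse_map m jM s (LinearMap.ext fun p ↦ ?_)
  obtain ⟨a, rfl⟩ := hfs p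
  have hcomm : jM (fs a) = fp (jF a) := by
    ext i
    simp [jM, fs, fp, jF]
  rw [LinearMap.comp_apply, hcomm, ← hs₀, ← hs]
  rfl
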